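/- Let A be a finite subset of an additive group G with φ(A) ≤ k, and let A₁, …, A_{k+1} be subsets of A, each of size at least n for some n ≥ 1. Then the number of tuples (a₁,…,a_{k+1}) ∈ A₁ × ⋯ × A_{k+1} such that the aᵢ are pairwise distinct and all sums aᵢ + aⱼ (i < j) lie outside A is zero; consequently, there exist indices 1 ≤ i < j ≤ k+1 such that |{(aᵢ, aⱼ) ∈ Aᵢ × Aⱼ : aᵢ + aⱼ ∈ A}| ≥ (2/(k(k+1))) · |Aᵢ||Aⱼ| − (k+1)² · (|Aᵢ||Aⱼ|/n). -/

import Mathlib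

/-- `phi A` is the maximum cardinality of a subset `B ⊆ A` that is sum-avoiding in `A`. -/
def phi {G : Type*} [AddCommGroup G] [DecidableEq G] (A : Finset G) : ℕ :=
  ((A.powerset).filter (fun B => ∀ b₁ ∈ B, ∀ b₂ ∈ B, b₁ ≠ b₂ → b₁ + b₂ ∉ A)).sup Finset.card

lemma avoid_card_le {G : Type*} [AddCommGroup G] [DecidableEq G] (A B : Finset G) (hB : B ⊆ A)
    (h : ∀ b₁ ∈ B, ∀ b₂ ∈ B, b₁ ≠ b₂ → b₁ + b₂ ∉ A) : B.card ≤ phi A := by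
  unfold phi
  exact Finset.le_sup (f := Finset.card) (Finset.mem_filter.2 ⟨Finset.mem_powerset.2 hB, h⟩)

lemma fiber_card {ι G : Type*} [Fintype ι] [DecidableEq ι] [DecidableEq G]
    (As : ι → Finset G) (i j : ι) (hij : i ≠ j) (x y : G) (hx : x ∈ As i) (hy : y ∈ As j) :
    ((Fintype.piFinset As).filter (fun a => (a i, a j) = (x, y))).card
      * ((As i).card * (As j).card) = ∏ l, (As l).card := by
  have h1 : (Fintype.piFinset As).filter (fun a => (a i, a j) = (x, y))
      = Fintype.piFinset (fun l => if l = i then {x} else if l = j then {y} else As l) := by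
    ext a
    simp only [Finset.mem_filter, Fintype.mem_piFinset, Prod.mk.injEq]
    constructor
    · rintro ⟨h, h1, h2⟩ l
      by_cases hl : l = i
      · subst hl; simp [h1]
      · by_cases hl' : l = j
        · subst hl'; simp [hl, h2]
        · simp [hl, hl', h l]
    · intro h
      have e1 : a i = x := by simpa using h i
      have e2 : a j = y := by simpa [hij.symm] using h j
      refine ⟨fun l => ?_, e1, e2⟩
      by_cases hl : l = i
      · subst hl; rwa [e1]
      · by_cases hl' : l = j
        · subst hl'; rwa [e2]
        · simpa [hl, hl'] using h l
  rw [h1, Fintype.card_piFinset]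
  have hj : j ∈ Finset.univ.erase i := by simp [hij.symm]
  rw [← Finset.mul_prod_erase Finset.univ _ (Finset.mem_univ i),
    ← Finset.mul_prod_erase _ _ hj,
    ← Finset.mul_prod_erase Finset.univ (fun l => (As l).card) (Finset.mem_univ i),
    ← Finset.mul_prod_erase _ (fun l => (As l).card) hj]
  have : ∏ l ∈ (Finset.univ.erase i).erase j,
      (if l = i then ({x} : Finset G) else if l = j then {y} else As l).card
      = ∏ l ∈ (Finset.univ.erase i).erase j, (As l).card := by
    refine Finset.prod_congr rfl fun l hl => ?_
    simp only [Finset.mem_erase] at hl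
    simp [hl.1, hl.2.1]
  rw [this]
  simp [hij.symm]
  ring

lemma event_card {ι G : Type*} [Fintype ι] [DecidableEq ι] [DecidableEq G]
    (As : ι → Finset G) (i j : ι) (hij : i ≠ j) (S : Finset (G × G)) (hS : S ⊆ As i ×ˢ As j) :
    ((Fintype.piFinset As).filter (fun a => (a i, a j) ∈ S)).card
      * ((As i).card * (As j).card) = S.card * ∏ l, (As l).card := by
  have h := Finset.card_eq_sum_card_fiberwise
    (s := (Fintype.piFinset As).filter (fun a => (a i, a j) ∈ S)) (t := S)
    (f := fun a => (a i, a j)) (by intro a ha; simpa using (Finset.mem_filter.1 ha).2)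
  rw [h, Finset.sum_mul, ← smul_eq_mul S.card, ← Finset.sum_const]
  refine Finset.sum_congr rfl ?_
  rintro ⟨x, y⟩ hp
  have hm := Finset.mem_product.1 (hS hp)
  rw [← fiber_card As i j hij x y hm.1 hm.2, Finset.filter_filter]
  congr 2
  ext a
  simp only [Finset.mem_filter]
  constructor
  · rintro ⟨h, _, h2⟩; exact ⟨h, h2⟩
  · rintro ⟨h, h2⟩; exact ⟨h, h2 ▸ hp, h2⟩

lemma pairs_card (k : ℕ) : ((Finset.univ : Finset (Fin (k+1) × Fin (k+1))).filter
    (fun p => p.1 < p.2)).card * 2 = (k + 1) * k := by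
  have : ((Finset.univ : Finset (Fin (k+1) × Fin (k+1))).filter
    (fun p => p.1 < p.2)).card = ∑ j : Fin (k+1), (j : ℕ) := by
    rw [Finset.card_filter, Fintype.sum_prod_type_right]
    refine Finset.sum_congr rfl fun j _ => ?_
    rw [← Finset.card_filter]
    have : (Finset.univ.filter fun i : Fin (k+1) => i < j) = Finset.Iio j := by ext; simp
    simp [this]
  rw [this, Fin.sum_univ_eq_sum_range (fun x => x), Finset.sum_range_id_mul_two]
  simp

theorem finitary_pigeonhole {G : Type*} [AddCommGroup G] [DecidableEq G]
    (k n : ℕ) (hn : 1 ≤ n)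
    (A : Finset G) (hphi : phi A ≤ k)
    (As : Fin (k + 1) → Finset G)
    (hsub : ∀ i, As i ⊆ A)
    (hcard : ∀ i, n ≤ (As i).card) :
    ((Fintype.piFinset As).filter
        (fun a => Function.Injective a ∧
          ∀ i j : Fin (k + 1), i ≠ j → a i + a j ∉ A)).card = 0 ∧
    ∃ i j : Fin (k + 1), i < j ∧
      ((2 : ℝ) / (k * (k + 1))) * ((As i).card * (As j).card)
          - ((k : ℝ) + 1) ^ 2 * ((As i).card * (As j).card / n)
        ≤ (((As i ×ˢ As j).filter (fun p => p.1 + p.2 ∈ A)).card : ℝ) := by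
  have hA : ∀ a ∈ Fintype.piFinset As, ¬ (Function.Injective a ∧
          ∀ i j : Fin (k + 1), i ≠ j → a i + a j ∉ A) := by
    rintro a ha ⟨hinj, hs⟩
    have h := avoid_card_le A (Finset.univ.image a) (by
      intro x hx
      obtain ⟨i, _, rfl⟩ := Finset.mem_image.1 hx
      exact hsub i (Fintype.mem_piFinset.1 ha i)) (by
      intro x hx y hy hxy
      obtain ⟨i, _, rfl⟩ := Finset.mem_image.1 hx
      obtain ⟨j, _, rfl⟩ := Finset.mem_image.1 hy
      exact hs i j (fun h => hxy (by rw [h])))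
    rw [Finset.card_image_of_injective _ hinj] at h
    simp at h
    omega
  refine ⟨by rw [Finset.card_eq_zero, Finset.filter_eq_empty_iff]; exact fun a ha => hA a ha, ?_⟩
  have hk : 1 ≤ k := by
    have h0 : 0 < (As 0).card := lt_of_lt_of_le hn (hcard 0)
    obtain ⟨x, hx⟩ := Finset.card_pos.1 h0
    have := avoid_card_le A {x} (by simpa using hsub 0 hx) (by
      intro a ha b hb hab
      simp only [Finset.mem_singleton] at ha hb
      exact absurd (ha.trans hb.symm) hab)
    simp at this
    omega
  by_contra! hcon
  set pr := (Finset.univ : Finset (Fin (k+1) × Fin (k+1))).filter (fun p => p.1 < p.2) with hpr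
  have hprc := pairs_card k
  rw [← hpr] at hprc
  have hkR : (1 : ℝ) ≤ k := by exact_mod_cast hk
  have hnR : (1 : ℝ) ≤ n := by exact_mod_cast hn
  set P : ℕ := ∏ l, (As l).card with hP
  have hpos : ∀ l, 0 < (As l).card := fun l => lt_of_lt_of_le hn (hcard l)
  have hPpos : 0 < P := Finset.prod_pos fun l _ => hpos l
  let S : Fin (k+1) × Fin (k+1) → Finset (G × G) := fun p =>
    (As p.1 ×ˢ As p.2).filter (fun q => q.1 = q.2 ∨ q.1 + q.2 ∈ A)
  let B : Fin (k+1) × Fin (k+1) → Finset (Fin (k+1) → G) := fun p =>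
    (Fintype.piFinset As).filter (fun a => (a p.1, a p.2) ∈ S p)
  have hcover : Fintype.piFinset As ⊆ pr.biUnion B := by
    intro a ha
    have ham := Fintype.mem_piFinset.1 ha
    have key : ∃ i j : Fin (k+1), i ≠ j ∧ (a i = a j ∨ a i + a j ∈ A) := by
      by_contra! hc
      exact hA a ha ⟨fun i j h => by
        by_contra hne
        exact (hc i j hne).1 h, fun i j hne => (hc i j hne).2⟩
    obtain ⟨i, j, hne, h⟩ := key
    rw [Finset.mem_biUnion]
    rcases lt_or_gt_of_ne hne with hlt | hlt
    · exact ⟨(i, j), by simp [hpr, hlt], by simp [B, S, ham, h]⟩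
    · refine ⟨(j, i), by simp [hpr, hlt], ?_⟩
      have h' : a j = a i ∨ a j + a i ∈ A := by
        rw [add_comm (a j)]; exact h.imp Eq.symm id
      simp [B, S, ham, h']
  have hB : ∀ p ∈ pr, ((B p).card : ℝ) < 2 / (k * (k + 1)) * P := by
    rintro ⟨i, j⟩ hp
    have hlt : i < j := by simpa [hpr] using hp
    have hev := event_card As i j hlt.ne (S (i, j)) (Finset.filter_subset _ _)
    have hSc : (S (i, j)).card ≤ (As i).card
        + ((As i ×ˢ As j).filter (fun p => p.1 + p.2 ∈ A)).card := by
      have : S (i, j) ⊆ (As i).image (fun x => (x, x)) ∪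
          (As i ×ˢ As j).filter (fun p => p.1 + p.2 ∈ A) := by
        rintro ⟨x, y⟩ hq
        simp only [S, Finset.mem_filter, Finset.mem_product] at hq
        rcases hq with ⟨⟨h1, h2⟩, h | h⟩
        · subst h
          exact Finset.mem_union_left _ (Finset.mem_image_of_mem _ h1)
        · exact Finset.mem_union_right _ (by simp [h1, h2, h])
      refine (Finset.card_le_card this).trans ((Finset.card_union_le _ _).trans ?_)
      gcongr
      exact Finset.card_image_le
    have hc := hcon i j hlt
    have hx : (0 : ℝ) < (As i).card := by exact_mod_cast hpos i
    have hy : (0 : ℝ) < (As j).card := by exact_mod_cast hpos j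
    have hyn : (n : ℝ) ≤ (As j).card := by exact_mod_cast hcard j
    have hScR : ((S (i, j)).card : ℝ) ≤ (As i).card
        + ((As i ×ˢ As j).filter (fun p => p.1 + p.2 ∈ A)).card := by exact_mod_cast hSc
    have hE : ((As i).card : ℝ) ≤ (As i).card * (As j).card / n := by
      rw [le_div_iff₀ (by linarith)]
      gcongr
    have hE2 : ((As i).card * (As j).card / n : ℝ) ≤
        ((k : ℝ) + 1) ^ 2 * ((As i).card * (As j).card / n) :=
      le_mul_of_one_le_left (by positivity) (by nlinarith)
    have hS : ((S (i, j)).card : ℝ) < 2 / (k * (k + 1)) * ((As i).card * (As j).card) := by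
      linarith
    have hPR : (0 : ℝ) < P := by exact_mod_cast hPpos
    have hevR : ((B (i, j)).card : ℝ) * ((As i).card * (As j).card) = (S (i, j)).card * P := by
      exact_mod_cast hev
    have hxy : (0 : ℝ) < (As i).card * (As j).card := mul_pos hx hy
    refine lt_of_mul_lt_mul_right ?_ hxy.le
    rw [hevR]
    calc _ < 2 / (k * (k + 1)) * ((As i).card * (As j).card : ℝ) * P :=
          mul_lt_mul_of_pos_right hS hPR
      _ = _ := by ring
  have hne : pr.Nonempty := by
    rw [← Finset.card_pos]
    have : 0 < (k + 1) * k := by positivity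
    omega
  have h1 : (P : ℝ) ≤ ∑ p ∈ pr, ((B p).card : ℝ) := by
    have := (Finset.card_le_card hcover).trans Finset.card_biUnion_le
    rw [Fintype.card_piFinset] at this
    exact_mod_cast this
  have h2 := Finset.sum_lt_sum_of_nonempty hne hB
  rw [Finset.sum_const, nsmul_eq_mul] at h2
  have h3 : (pr.card : ℝ) * 2 = (k + 1) * k := by exact_mod_cast hprc
  have h4 : (pr.card : ℝ) * (2 / (k * (k + 1)) * P) = P := by
    have : (pr.card : ℝ) = (k + 1) * k / 2 := by linarith
    rw [this]
    field_simp
  linarith
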